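/- arXiv:2305.18362 — 2 statements merged into one kernel-verified Lean document; each statement's English description precedes it below -/
import Mathlib

section
/- Let p be a positive integer, W : Fin p → ℝ, H₀ ⊆ Fin p a finite set of indices (nulls), τ > 0 and q ≥ 0 real numbers. Let N⁺ = #{j : W_j ≥ τ}, N⁻ = #{j : W_j ≤ −τ}, N⁺₀ = #{j ∈ H₀ : W_j ≥ τ}, and N⁻₀ = #{j ∈ H₀ : W_j ≤ −τ}. If 1 + N⁻ ≤ q · N⁺, then the false discovery proportion satisfies (N⁺₀) / max(1, N⁺) ≤ q · N⁺₀ / (1 + N⁻₀). -/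
open Finset

/-- Deterministic first step of the knockoff FDR-control proof.
If the knockoff threshold condition `1 + #{j : W j ≤ -τ} ≤ q · #{j : W j ≥ τ}` holds,
then the false discovery proportion of `Ŝ = {j : W j ≥ τ}` relative to the nulls `H₀`
is at most `q · N⁺₀ / (1 + N⁻₀)`. -/
theorem knockoff_fdp_deterministic_bound
    (p : ℕ) (hp : 0 < p) (W : Fin p → ℝ) (H0 : Finset (Fin p)) (τ q : ℝ)
    (hτ : 0 < τ) (hq : 0 ≤ q)
    (hthresh :
      (1 : ℝ) + ((univ.filter fun j => W j ≤ -τ).card : ℝ)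
        ≤ q * ((univ.filter fun j => τ ≤ W j).card : ℝ)) :
    ((H0.filter fun j => τ ≤ W j).card : ℝ)
        / max 1 ((univ.filter fun j => τ ≤ W j).card : ℝ)
      ≤ q * ((H0.filter fun j => τ ≤ W j).card : ℝ)
        / (1 + ((H0.filter fun j => W j ≤ -τ).card : ℝ)) := by
  have hnull : ((H0.filter fun j => W j ≤ -τ).card : ℝ)
      ≤ ((univ.filter fun j => W j ≤ -τ).card : ℝ) := by
    exact_mod_cast card_le_card (filter_subset_filter _ (subset_univ H0))
  have hmax : 1 + ((H0.filter fun j => W j ≤ -τ).card : ℝ)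
      ≤ q * max 1 ((univ.filter fun j => τ ≤ W j).card : ℝ) := by
    have := mul_le_mul_of_nonneg_left
      (le_max_right (1 : ℝ) ((univ.filter fun j => τ ≤ W j).card : ℝ)) hq
    linarith
  rw [div_le_div_iff₀ (by positivity) (by positivity), mul_comm q, mul_assoc]
  gcongr
end

section
/- Let (Ω, P) be a probability space, p a positive integer, W : Ω → (Fin p → ℝ) a measurable random vector of knockoff statistics, H₀ ⊆ Fin p a set of nulls, and q ∈ (0,1). Assume the null sign-flip invariance: for every ε : Fin p → ℝ taking values in {−1, 1} with ε_j = 1 for every j ∉ H₀, the random vector (ε_j · W_j)_{j} has the same distribution as W. For each ω, let τ(ω) be the minimum element t of the finite set {|W_j(ω)| : j ∈ Fin p, W_j(ω) ≠ 0} satisfying 1 + #{j : W_j(ω) ≤ −t} ≤ q · #{j : W_j(ω) ≥ t}, if such an element exists, and in that case set Ŝ(ω) = {j : W_j(ω) ≥ τ(ω)}; if no such t exists set Ŝ(ω) = ∅. Then the false discovery rate is controlled: E[ |Ŝ ∩ H₀| / max(1, |Ŝ|) ] ≤ q. -/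
open MeasureTheory Finset

open scoped Classical

/-- The knockoff selected set: `τ` is the minimum nonzero magnitude `t` among the
`|W j|` satisfying `1 + #{j : W j ≤ -t} ≤ q · #{j : W j ≥ t}`, and the selected set is
`{j : W j ≥ τ}` (empty if no such `t` exists). -/
noncomputable def knockoffSelected (p : ℕ) (q : ℝ) (W : Fin p → ℝ) : Finset (Fin p) :=
  let T : Finset ℝ := (univ.filter fun j => W j ≠ 0).image fun j => |W j|
  let T' : Finset ℝ := T.filter fun t =>
    (1 : ℝ) + ((univ.filter fun j => W j ≤ -t).card : ℝ)
      ≤ q * ((univ.filter fun j => t ≤ W j).card : ℝ)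
  if h : T'.Nonempty then univ.filter fun j => T'.min' h ≤ W j else ∅

/-- `t` is a magnitude of `W` at which the estimated false discovery proportion is at most `q`. -/
def IsKnockoffFeasible {p : ℕ} (q : ℝ) (W : Fin p → ℝ) (t : ℝ) : Prop :=
  (∃ i, W i ≠ 0 ∧ |W i| = t) ∧
    (1 : ℝ) + ((univ.filter fun j => W j ≤ -t).card : ℝ)
      ≤ q * ((univ.filter fun j => t ≤ W j).card : ℝ)

lemma IsKnockoffFeasible.pos {p : ℕ} {q : ℝ} {W : Fin p → ℝ} {t : ℝ}
    (h : IsKnockoffFeasible q W t) : 0 < t := by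
  obtain ⟨⟨i, hi, rfl⟩, -⟩ := h
  exact abs_pos.mpr hi

lemma exists_isLeast_of_mem_knockoffSelected {p : ℕ} {q : ℝ} {W : Fin p → ℝ} {j : Fin p}
    (hj : j ∈ knockoffSelected p q W) :
    ∃ t, IsLeast {s | IsKnockoffFeasible q W s} t ∧
      knockoffSelected p q W = univ.filter fun i => t ≤ W i := by
  unfold knockoffSelected at hj ⊢
  dsimp only at hj ⊢
  split_ifs at hj ⊢ with h
  · refine ⟨_, ⟨?_, fun s hs => ?_⟩, rfl⟩
    · simpa [IsKnockoffFeasible] using Finset.min'_mem _ h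
    · exact Finset.min'_le _ _ (by simpa [IsKnockoffFeasible] using hs)
  · simp at hj

lemma mem_knockoffSelected_iff {p : ℕ} {q : ℝ} {W : Fin p → ℝ} {j : Fin p} :
    j ∈ knockoffSelected p q W ↔ ∃ i, IsKnockoffFeasible q W |W i| ∧ |W i| ≤ W j := by
  constructor
  · intro hj
    obtain ⟨t, ⟨ht, -⟩, hS⟩ := exists_isLeast_of_mem_knockoffSelected hj
    obtain ⟨i, -, rfl⟩ := ht.1
    exact ⟨i, ht, by simpa [hS] using hj⟩
  · rintro ⟨i, hi, hij⟩
    have hmem : |W i| ∈ (((univ.filter fun j => W j ≠ 0).image fun j => |W j|).filter fun t =>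
        (1 : ℝ) + ((univ.filter fun j => W j ≤ -t).card : ℝ)
          ≤ q * ((univ.filter fun j => t ≤ W j).card : ℝ)) := by
      simpa [IsKnockoffFeasible] using hi
    unfold knockoffSelected
    dsimp only
    rw [dif_pos ⟨_, hmem⟩, mem_filter]
    exact ⟨mem_univ j, (Finset.min'_le _ _ hmem).trans hij⟩

/-- The vector `W` with the sign of its `j`-th entry flipped. -/
def flipSign {p : ℕ} (j : Fin p) (W : Fin p → ℝ) : Fin p → ℝ :=
  Function.update W j (-W j)

lemma flipSign_self {p : ℕ} (j : Fin p) (W : Fin p → ℝ) : flipSign j W j = -W j := by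
  simp [flipSign]

lemma flipSign_of_ne {p : ℕ} {i j : Fin p} (h : i ≠ j) (W : Fin p → ℝ) :
    flipSign j W i = W i := by
  simp [flipSign, h]

lemma abs_flipSign {p : ℕ} (i j : Fin p) (W : Fin p → ℝ) : |flipSign j W i| = |W i| := by
  by_cases h : i = j
  · subst h; simp [flipSign_self]
  · rw [flipSign_of_ne h]

lemma card_flipSign_le_neg {p : ℕ} {j : Fin p} {W : Fin p → ℝ} {t : ℝ} (ht : 0 < t)
    (hj : W j ≤ -t) :
    (1 : ℝ) + ((univ.filter fun i => flipSign j W i ≤ -t).card : ℝ)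
      = ((univ.filter fun i => W i ≤ -t).card : ℝ) := by
  have h : (univ.filter fun i => flipSign j W i ≤ -t)
      = (univ.filter fun i => W i ≤ -t).erase j := by
    ext i
    by_cases hi : i = j
    · subst hi
      simp [flipSign_self]
      linarith
    · simp [flipSign_of_ne hi, hi]
  rw [h, add_comm]
  exact_mod_cast card_erase_add_one (by simpa using hj)

lemma card_le_flipSign {p : ℕ} {j : Fin p} {W : Fin p → ℝ} {t : ℝ} (ht : 0 < t)
    (hj : W j ≤ -t) :
    (univ.filter fun i => t ≤ flipSign j W i).card
      = (univ.filter fun i => t ≤ W i).card + 1 := by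
  have h : (univ.filter fun i => t ≤ flipSign j W i)
      = insert j (univ.filter fun i => t ≤ W i) := by
    ext i
    by_cases hi : i = j
    · subst hi
      simp [flipSign_self]
      linarith
    · simp [flipSign_of_ne hi, hi]
  rw [h, card_insert_of_notMem]
  simp
  linarith

lemma isKnockoffFeasible_flipSign_iff {p : ℕ} {q : ℝ} {j : Fin p} {W : Fin p → ℝ} {t : ℝ}
    (ht : 0 < t) (hj : W j ≤ -t) :
    IsKnockoffFeasible q (flipSign j W) t ↔
      (∃ i, W i ≠ 0 ∧ |W i| = t) ∧
        ((univ.filter fun i => W i ≤ -t).card : ℝ)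
          ≤ q * (((univ.filter fun i => t ≤ W i).card + 1 : ℕ) : ℝ) := by
  unfold IsKnockoffFeasible
  rw [card_flipSign_le_neg ht hj, card_le_flipSign ht hj]
  simp only [abs_flipSign, ← abs_pos]

/-- The variables that become selected when their own sign is flipped are few compared with the
selection made after any one of these flips. -/
lemma card_filter_mem_flipSign_le {p : ℕ} {q : ℝ} (W : Fin p → ℝ) {j : Fin p}
    (hj : j ∈ knockoffSelected p q (flipSign j W)) :
    ((univ.filter fun k => k ∈ knockoffSelected p q (flipSign k W)).card : ℝ)
      ≤ q * ((knockoffSelected p q (flipSign j W)).card : ℝ) := by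
  obtain ⟨t, ⟨ht, hmin⟩, hS⟩ := exists_isLeast_of_mem_knockoffSelected hj
  have hjt : W j ≤ -t := by
    have : t ≤ flipSign j W j := by simpa [hS] using hj
    rw [flipSign_self] at this
    linarith
  have hsub : (univ.filter fun k => k ∈ knockoffSelected p q (flipSign k W))
      ⊆ univ.filter fun i => W i ≤ -t := by
    intro k hk
    rw [mem_filter] at hk ⊢
    obtain ⟨s, ⟨hs, -⟩, hS'⟩ := exists_isLeast_of_mem_knockoffSelected hk.2
    have hks : W k ≤ -s := by
      have : s ≤ flipSign k W k := by simpa [hS'] using hk.2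
      rw [flipSign_self] at this
      linarith
    have hts : t ≤ s := by
      by_contra! hlt
      refine hlt.not_ge (hmin ?_)
      exact (isKnockoffFeasible_flipSign_iff hs.pos (by linarith)).mpr
        ((isKnockoffFeasible_flipSign_iff hs.pos hks).mp hs)
    exact ⟨mem_univ k, by linarith⟩
  calc _ ≤ ((univ.filter fun i => W i ≤ -t).card : ℝ) := by exact_mod_cast card_le_card hsub
    _ ≤ q * (((univ.filter fun i => t ≤ W i).card + 1 : ℕ) : ℝ) :=
        ((isKnockoffFeasible_flipSign_iff ht.pos hjt).mp ht).2
    _ = _ := by rw [hS, card_le_flipSign ht.pos hjt]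

/-- The contribution of the variable `j` to the false discovery proportion. -/
noncomputable def knockoffShare (p : ℕ) (q : ℝ) (j : Fin p) (W : Fin p → ℝ) : ℝ :=
  (if j ∈ knockoffSelected p q W then 1 else 0) / max 1 ((knockoffSelected p q W).card : ℝ)

lemma sum_knockoffShare {p : ℕ} (q : ℝ) (H : Finset (Fin p)) (W : Fin p → ℝ) :
    ∑ j ∈ H, knockoffShare p q j W
      = ((knockoffSelected p q W ∩ H).card : ℝ) / max 1 ((knockoffSelected p q W).card : ℝ) := by
  simp only [knockoffShare]
  rw [← Finset.sum_div, Finset.sum_boole, Finset.filter_mem_eq_inter, Finset.inter_comm]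

lemma sum_knockoffShare_flipSign_le {p : ℕ} {q : ℝ} (hq : 0 ≤ q) (H : Finset (Fin p))
    (W : Fin p → ℝ) :
    ∑ j ∈ H, knockoffShare p q j (flipSign j W) ≤ q := by
  set A := univ.filter fun k => k ∈ knockoffSelected p q (flipSign k W) with hA
  have hle : ∀ j, knockoffShare p q j (flipSign j W) ≤ if j ∈ A then q / A.card else 0 := by
    intro j
    by_cases hj : j ∈ knockoffSelected p q (flipSign j W)
    · have hjA : j ∈ A := by simpa [hA] using hj
      have hpos : (0 : ℝ) < A.card := by exact_mod_cast card_pos.mpr ⟨j, hjA⟩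
      have hN : (1 : ℝ) ≤ (knockoffSelected p q (flipSign j W)).card := by
        exact_mod_cast card_pos.mpr ⟨j, hj⟩
      rw [knockoffShare, if_pos hj, if_pos hjA, max_eq_right hN,
        div_le_div_iff₀ (by linarith) hpos, one_mul]
      exact card_filter_mem_flipSign_le W hj
    · have hjA : j ∉ A := by simpa [hA] using hj
      simp [knockoffShare, hj, hjA]
  calc _ ≤ ∑ j ∈ H, (if j ∈ A then q / A.card else 0) := sum_le_sum fun j _ => hle j
    _ ≤ ∑ j, (if j ∈ A then q / A.card else 0) :=
        sum_le_sum_of_subset_of_nonneg (subset_univ H) fun j _ _ => by positivity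
    _ = A.card * (q / A.card) := by simp
    _ ≤ q := by
        rcases eq_or_ne (A.card : ℝ) 0 with h | h
        · simpa [h] using hq
        · rw [mul_div_cancel₀ _ h]

lemma measurable_flipSign {p : ℕ} (j : Fin p) : Measurable (flipSign j) := by
  refine measurable_pi_lambda _ fun i => ?_
  by_cases h : i = j
  · subst h
    simp only [flipSign_self]
    fun_prop
  · simp only [flipSign_of_ne h]
    fun_prop

lemma measurable_card_filter {α ι : Type*} [MeasurableSpace α] [Fintype ι] {r : α → ι → Prop}
    (hr : ∀ i, MeasurableSet {a | r a i}) :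
    Measurable fun a => ((univ.filter (r a)).card : ℝ) := by
  simp only [← Finset.sum_boole]
  exact Finset.measurable_sum _ fun i _ => Measurable.ite (hr i) measurable_const measurable_const

lemma measurableSet_mem_knockoffSelected {p : ℕ} (q : ℝ) (j : Fin p) :
    MeasurableSet {W | j ∈ knockoffSelected p q W} := by
  have habs : ∀ i : Fin p, Measurable fun W : Fin p → ℝ => |W i| := fun i =>
    (measurable_pi_apply i).abs
  simp only [mem_knockoffSelected_iff, IsKnockoffFeasible, Set.ofPred_exists, Set.ofPred_and]
  refine .iUnion fun i => .inter (.inter (.iUnion fun k => .inter ?_ ?_) ?_) ?_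
  · exact (measurableSet_eq_fun (measurable_pi_apply k) measurable_const).compl
  · exact measurableSet_eq_fun (habs k) (habs i)
  · exact measurableSet_le
      (measurable_const.add (measurable_card_filter fun l =>
        measurableSet_le (measurable_pi_apply l) (habs i).neg))
      (measurable_const.mul (measurable_card_filter fun l =>
        measurableSet_le (habs i) (measurable_pi_apply l)))
  · exact measurableSet_le (habs i) (measurable_pi_apply j)

lemma measurable_knockoffShare {p : ℕ} (q : ℝ) (j : Fin p) :
    Measurable (knockoffShare p q j) := by
  have hcard : Measurable fun W => ((knockoffSelected p q W).card : ℝ) := by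
    simpa using measurable_card_filter (measurableSet_mem_knockoffSelected (p := p) q)
  exact (Measurable.ite (measurableSet_mem_knockoffSelected q j) measurable_const
    measurable_const).div (measurable_const.max hcard)

lemma norm_knockoffShare_le {p : ℕ} (q : ℝ) (j : Fin p) (W : Fin p → ℝ) :
    ‖knockoffShare p q j W‖ ≤ 1 := by
  have h1 : (1 : ℝ) ≤ max 1 ((knockoffSelected p q W).card : ℝ) := le_max_left _ _
  rw [knockoffShare, Real.norm_of_nonneg (by positivity), div_le_one (by linarith)]
  split_ifs <;> linarith

/-- Theorem 1, knockoff+ FDR control: if flipping the signs of any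
subset of the null statistics leaves the distribution of `W` unchanged, then the
knockoff+ procedure at level `q ∈ (0,1)` controls the false discovery rate:
`E[ |Ŝ ∩ H₀| / max(1, |Ŝ|) ] ≤ q`. -/
theorem knockoff_fdr_control
    {Ω : Type*} [MeasurableSpace Ω] (P : Measure Ω) [IsProbabilityMeasure P]
    (p : ℕ) (hp : 0 < p) (W : Ω → Fin p → ℝ) (hW : Measurable W)
    (H0 : Finset (Fin p)) (q : ℝ) (hq0 : 0 < q) (hq1 : q < 1)
    (hflip : ∀ ε : Fin p → ℝ, (∀ j, ε j = 1 ∨ ε j = -1) → (∀ j ∉ H0, ε j = 1) →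
      Measure.map (fun ω => fun j => ε j * W ω j) P = Measure.map W P) :
    ∫ ω, ((knockoffSelected p q (W ω) ∩ H0).card : ℝ)
        / max 1 ((knockoffSelected p q (W ω)).card : ℝ) ∂P ≤ q := by
  have hint : ∀ (j : Fin p) (V : Ω → Fin p → ℝ), Measurable V →
      Integrable (fun ω => knockoffShare p q j (V ω)) P := fun j V hV =>
    .of_bound ((measurable_knockoffShare q j).comp hV).aestronglyMeasurable 1
      (.of_forall fun ω => norm_knockoffShare_le q j (V ω))
  have hflipW : ∀ j, Measurable fun ω => flipSign j (W ω) := fun j =>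
    (measurable_flipSign j).comp hW
  have hswap : ∀ j ∈ H0, ∫ ω, knockoffShare p q j (W ω) ∂P
      = ∫ ω, knockoffShare p q j (flipSign j (W ω)) ∂P := by
    intro j hj
    have hlaw : Measure.map (fun ω => flipSign j (W ω)) P = Measure.map W P := by
      rw [← hflip (fun i => if i = j then -1 else 1) (fun i => by by_cases h : i = j <;> simp [h])
        (fun i hi => if_neg (ne_of_mem_of_not_mem hj hi).symm)]
      congr 1
      ext ω i
      by_cases h : i = j
      · subst h
        simp [flipSign_self]
      · simp [flipSign_of_ne h, h]
    have hmeas := (measurable_knockoffShare (p := p) q j).stronglyMeasurable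
    rw [← integral_map hW.aemeasurable hmeas.aestronglyMeasurable, ← hlaw,
      integral_map (hflipW j).aemeasurable hmeas.aestronglyMeasurable]
  simp only [← sum_knockoffShare]
  rw [integral_finsetSum _ fun j _ => hint j W hW, sum_congr rfl hswap,
    ← integral_finsetSum _ fun j _ => hint j _ (hflipW j)]
  calc _ ≤ ∫ _, q ∂P := integral_mono
          (integrable_finsetSum _ fun j _ => hint j _ (hflipW j))
          (integrable_const q) fun ω => sum_knockoffShare_flipSign_le hq0.le H0 (W ω)
    _ = q := by simp
end
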